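/- arXiv:1412.3287 — 2 statements merged into one kernel-verified Lean document; each statement's English description precedes it below -/
import Mathlib

section
/- Let A be a normal fanning frame (so P_1 ≡ 0) with coefficient curves P_2,…,P_k, horizontal derivative H(t) and Jacobi endomorphism K(t). Then for every t ∈ ℝ: K(t)·A^{(i)}(t) = 0 for all 0 ≤ i ≤ k−3; K(t)·A^{(k−2)}(t) = Σ_{j=1}^{k−1} C(k−1,j)·A^{(k−1−j)}(t)·(P_{j+1}(t) − P_j'(t)) (where P_1 = 0); and K(t)·H(t) = (k−1)·H(t)·P_2(t). (These identities say that in the basis of ℝ^{kn} formed by the columns of (A|A^{(1)}|…|A^{(k−2)}|H), the matrix of the Jacobi endomorphism is the matrix of Theorem jacobik, with κ = P_2 and h_j = P_{j+2}.) -/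
open Matrix

noncomputable def mderiv {M N : ℕ} (A : ℝ → Matrix (Fin M) (Fin N) ℝ) :
    ℝ → Matrix (Fin M) (Fin N) ℝ :=
  fun t => Matrix.of fun i j => deriv (fun s => A s i j) t

noncomputable def dmat {M N : ℕ} (i : ℕ) (A : ℝ → Matrix (Fin M) (Fin N) ℝ) :
    ℝ → Matrix (Fin M) (Fin N) ℝ :=
  mderiv^[i] A

def MatSmooth {M N : ℕ} (A : ℝ → Matrix (Fin M) (Fin N) ℝ) : Prop :=
  ∀ i j, ContDiff ℝ (⊤ : ℕ∞) fun t => A t i j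

def juxt (k n : ℕ) (B : Fin k → Matrix (Fin (k * n)) (Fin n) ℝ) :
    Matrix (Fin (k * n)) (Fin (k * n)) ℝ :=
  Matrix.of fun r c => B (finProdFinEquiv.symm c).1 r (finProdFinEquiv.symm c).2

noncomputable def frameMat (k n : ℕ) (A : ℝ → Matrix (Fin (k * n)) (Fin n) ℝ) (t : ℝ) :
    Matrix (Fin (k * n)) (Fin (k * n)) ℝ :=
  juxt k n fun i => dmat (i : ℕ) A t

def IsFanning (k n : ℕ) (A : ℝ → Matrix (Fin (k * n)) (Fin n) ℝ) : Prop :=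
  MatSmooth A ∧ ∀ t, IsUnit (frameMat k n A t)

def IsCoeffs (k n : ℕ) (A : ℝ → Matrix (Fin (k * n)) (Fin n) ℝ)
    (P : ℕ → ℝ → Matrix (Fin n) (Fin n) ℝ) : Prop :=
  (∀ i ∈ Finset.Icc 1 k, MatSmooth (P i)) ∧
  ∀ t, dmat k A t + ∑ i ∈ Finset.Icc 1 k, (k.choose i : ℝ) • (dmat (k - i) A t * P i t) = 0

noncomputable def Nmat (k n : ℕ) : Matrix (Fin (k * n)) (Fin (k * n)) ℝ :=
  Matrix.of fun r c =>
    if ((finProdFinEquiv.symm c).1 : ℕ) = ((finProdFinEquiv.symm r).1 : ℕ) + 1 ∧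
        (finProdFinEquiv.symm c).2 = (finProdFinEquiv.symm r).2 then
      (((finProdFinEquiv.symm r).1 : ℕ) + 1 : ℝ)
    else 0

noncomputable def fundEnd (k n : ℕ) (A : ℝ → Matrix (Fin (k * n)) (Fin n) ℝ) (t : ℝ) :
    Matrix (Fin (k * n)) (Fin (k * n)) ℝ :=
  frameMat k n A t * Nmat k n * (frameMat k n A t)⁻¹

noncomputable def fundRefl (k n : ℕ) (A : ℝ → Matrix (Fin (k * n)) (Fin n) ℝ) (t : ℝ) :
    Matrix (Fin (k * n)) (Fin (k * n)) ℝ :=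
  (k : ℝ)⁻¹ • ((2 : ℝ) • mderiv (fundEnd k n A) t - ((k : ℝ) - 2) • (1 : Matrix (Fin (k * n)) (Fin (k * n)) ℝ))

noncomputable def fundProj (k n : ℕ) (A : ℝ → Matrix (Fin (k * n)) (Fin n) ℝ) (t : ℝ) :
    Matrix (Fin (k * n)) (Fin (k * n)) ℝ :=
  (2 : ℝ)⁻¹ • ((1 : Matrix (Fin (k * n)) (Fin (k * n)) ℝ) - fundRefl k n A t)

noncomputable def horDer (k n : ℕ) (A : ℝ → Matrix (Fin (k * n)) (Fin n) ℝ)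
    (P : ℕ → ℝ → Matrix (Fin n) (Fin n) ℝ) (t : ℝ) : Matrix (Fin (k * n)) (Fin n) ℝ :=
  dmat (k - 1) A t + ∑ i ∈ Finset.Icc 1 (k - 1), ((k - 1).choose i : ℝ) • (dmat (k - 1 - i) A t * P i t)

noncomputable def jacobiEnd (k n : ℕ) (A : ℝ → Matrix (Fin (k * n)) (Fin n) ℝ) (t : ℝ) :
    Matrix (Fin (k * n)) (Fin (k * n)) ℝ :=
  (((k : ℝ)) ^ 2)⁻¹ • (mderiv (mderiv (fundEnd k n A)) t * mderiv (mderiv (fundEnd k n A)) t)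

/-- Entrywise differentiability of a matrix-valued curve. -/
def HasMatDerivAt {M N : ℕ} (A : ℝ → Matrix (Fin M) (Fin N) ℝ) (A' : Matrix (Fin M) (Fin N) ℝ)
    (t : ℝ) : Prop :=
  ∀ i j, HasDerivAt (fun s => A s i j) (A' i j) t

namespace HasMatDerivAt

variable {L M N : ℕ} {A B : ℝ → Matrix (Fin M) (Fin N) ℝ} {A' B' : Matrix (Fin M) (Fin N) ℝ}
  {t : ℝ}

theorem mderiv_eq (h : HasMatDerivAt A A' t) : mderiv A t = A' := by
  ext i j
  exact (h i j).deriv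

theorem add (hA : HasMatDerivAt A A' t) (hB : HasMatDerivAt B B' t) :
    HasMatDerivAt (fun s => A s + B s) (A' + B') t :=
  fun i j => (hA i j).add (hB i j)

theorem const_smul (c : ℝ) (hA : HasMatDerivAt A A' t) :
    HasMatDerivAt (fun s => c • A s) (c • A') t :=
  fun i j => (hA i j).const_mul c

theorem sum {ι : Type*} {s : Finset ι} {f : ι → ℝ → Matrix (Fin M) (Fin N) ℝ}
    {f' : ι → Matrix (Fin M) (Fin N) ℝ} (h : ∀ a ∈ s, HasMatDerivAt (f a) (f' a) t) :
    HasMatDerivAt (fun x => ∑ a ∈ s, f a x) (∑ a ∈ s, f' a) t := by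
  intro i j
  simp only [Matrix.sum_apply]
  exact HasDerivAt.fun_sum fun a ha => h a ha i j

theorem mul {C : ℝ → Matrix (Fin N) (Fin L) ℝ} {C' : Matrix (Fin N) (Fin L) ℝ}
    (hA : HasMatDerivAt A A' t) (hC : HasMatDerivAt C C' t) :
    HasMatDerivAt (fun s => A s * C s) (A' * C t + A t * C') t := by
  intro i j
  simp only [Matrix.add_apply, Matrix.mul_apply, ← Finset.sum_add_distrib]
  exact HasDerivAt.fun_sum fun a _ => (hA i a).mul (hC a j)

end HasMatDerivAt

namespace MatSmooth

variable {L M N : ℕ} {A : ℝ → Matrix (Fin M) (Fin N) ℝ}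

theorem hasMatDerivAt (hA : MatSmooth A) (t : ℝ) : HasMatDerivAt A (mderiv A t) t :=
  fun i j => ((hA i j).differentiable (by simp) t).hasDerivAt

theorem mderiv (hA : MatSmooth A) : MatSmooth (mderiv A) :=
  fun i j => (contDiff_infty_iff_deriv.1 (hA i j)).2

theorem mul {C : ℝ → Matrix (Fin N) (Fin L) ℝ} (hA : MatSmooth A) (hC : MatSmooth C) :
    MatSmooth (fun t => A t * C t) := by
  intro i j
  simp only [Matrix.mul_apply]
  exact ContDiff.sum fun a _ => (hA i a).mul (hC a j)

theorem det {A : ℝ → Matrix (Fin M) (Fin M) ℝ} (hA : MatSmooth A) :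
    ContDiff ℝ (⊤ : ℕ∞) fun t => (A t).det := by
  simp only [Matrix.det_apply']
  exact ContDiff.sum fun σ _ => contDiff_const.mul (contDiff_prod fun a _ => hA _ _)

theorem adjugate {A : ℝ → Matrix (Fin M) (Fin M) ℝ} (hA : MatSmooth A) :
    MatSmooth fun t => (A t).adjugate := by
  intro i j
  simp only [Matrix.adjugate_apply]
  refine det fun a b => ?_
  by_cases h : a = j
  · subst h
    simpa using contDiff_const
  · simpa [Matrix.updateRow_ne h] using hA a b

theorem inv {A : ℝ → Matrix (Fin M) (Fin M) ℝ} (hA : MatSmooth A) (hu : ∀ t, IsUnit (A t)) :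
    MatSmooth fun t => (A t)⁻¹ := by
  intro i j
  simp only [Matrix.inv_def, Ring.inverse_eq_inv', Matrix.smul_apply, smul_eq_mul]
  exact (hA.det.inv fun t => ((Matrix.isUnit_iff_isUnit_det _).1 (hu t)).ne_zero).mul
    (hA.adjugate i j)

end MatSmooth

theorem dmat_succ {M N : ℕ} (i : ℕ) (A : ℝ → Matrix (Fin M) (Fin N) ℝ) :
    dmat (i + 1) A = mderiv (dmat i A) :=
  Function.iterate_succ_apply' _ _ _

theorem MatSmooth.dmat {M N : ℕ} {A : ℝ → Matrix (Fin M) (Fin N) ℝ} (hA : MatSmooth A) (i : ℕ) :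
    MatSmooth (dmat i A) := by
  induction i with
  | zero => exact hA
  | succ i ih => rw [dmat_succ]; exact ih.mderiv

theorem MatSmooth.hasMatDerivAt_dmat {M N : ℕ} {A : ℝ → Matrix (Fin M) (Fin N) ℝ}
    (hA : MatSmooth A) (i : ℕ) (t : ℝ) :
    HasMatDerivAt (_root_.dmat i A) (_root_.dmat (i + 1) A t) t := by
  rw [dmat_succ]
  exact (hA.dmat i).hasMatDerivAt t

theorem sum_Icc_one_eq_sum_range {V : Type*} [AddCommMonoid V] (m : ℕ) (f : ℕ → V) :
    ∑ i ∈ Finset.Icc 1 m, f i = ∑ i ∈ Finset.range m, f (i + 1) := by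
  rw [← Finset.Ico_add_one_right_eq_Icc, Finset.sum_Ico_eq_sum_range]
  simp [add_comm]

/-- Pascal's rule for binomially weighted sums. -/
theorem sum_choose_succ_smul {V : Type*} [AddCommGroup V] [Module ℝ V] (m : ℕ) (T : ℕ → V) :
    ∑ i ∈ Finset.Icc 1 (m + 1), ((m + 1).choose i : ℝ) • T i =
      T 1 + ∑ i ∈ Finset.Icc 1 m, (m.choose i : ℝ) • (T i + T (i + 1)) := by
  simp only [sum_Icc_one_eq_sum_range, Nat.choose_succ_succ, Nat.cast_add, add_smul, smul_add,
    Finset.sum_add_distrib]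
  rw [Finset.sum_range_succ', Finset.sum_range_succ (fun i => (m.choose (i + 1) : ℝ) • T (i + 1))]
  simp
  abel

theorem mul_juxt_apply (k n : ℕ) (M : Matrix (Fin (k * n)) (Fin (k * n)) ℝ)
    (B : Fin k → Matrix (Fin (k * n)) (Fin n) ℝ) (j : Fin k) (r : Fin (k * n)) (c : Fin n) :
    (M * juxt k n B) r (finProdFinEquiv (j, c)) = (M * B j) r c := by
  simp only [Matrix.mul_apply, juxt, Matrix.of_apply, Equiv.symm_apply_apply]

theorem juxt_mul_Nmat_apply (k n : ℕ) (B : ℕ → Matrix (Fin (k * n)) (Fin n) ℝ) (j : Fin k)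
    (r : Fin (k * n)) (c : Fin n) :
    (juxt k n (fun i => B i) * Nmat k n) r (finProdFinEquiv (j, c)) =
      (j : ℝ) * B (j - 1) r c := by
  rw [Matrix.mul_apply, ← finProdFinEquiv.sum_comp, Fintype.sum_prod_type]
  simp only [juxt, Nmat, Matrix.of_apply, Equiv.symm_apply_apply, ite_and, mul_ite, mul_zero]
  obtain ⟨j, hj⟩ := j
  cases j with
  | zero => simp
  | succ j =>
    rw [Finset.sum_eq_single ⟨j, by omega⟩]
    · simp [mul_comm]
    · intro b _ hb
      have : ¬ j = (b : ℕ) := fun h => hb (Fin.ext h.symm)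
      simp [this]
    · simp

namespace IsFanning

section

variable {k n : ℕ} {A : ℝ → Matrix (Fin (k * n)) (Fin n) ℝ}

theorem fundEnd_mul_dmat (hA : IsFanning k n A) {j : ℕ} (hj : j < k) (t : ℝ) :
    fundEnd k n A t * dmat j A t = (j : ℝ) • dmat (j - 1) A t := by
  have h : fundEnd k n A t * frameMat k n A t = frameMat k n A t * Nmat k n := by
    rw [fundEnd, Matrix.mul_assoc, Matrix.nonsing_inv_mul _
      ((Matrix.isUnit_iff_isUnit_det _).1 (hA.2 t)), Matrix.mul_one]
  ext r c
  have h1 := congrFun (congrFun h r) (finProdFinEquiv (⟨j, hj⟩, c))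
  rw [frameMat, mul_juxt_apply, juxt_mul_Nmat_apply k n (fun i => dmat i A t)] at h1
  exact h1

theorem matSmooth_fundEnd (hA : IsFanning k n A) : MatSmooth (fundEnd k n A) := by
  have h : MatSmooth (frameMat k n A) := fun _ _ => hA.1.dmat _ _ _
  exact (h.mul (C := fun _ => Nmat k n) fun _ _ => contDiff_const).mul (h.inv hA.2)

theorem mderiv_fundEnd_mul_add (hA : IsFanning k n A) {j : ℕ} (hj : j < k) (t : ℝ) :
    mderiv (fundEnd k n A) t * dmat j A t + fundEnd k n A t * dmat (j + 1) A t =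
      (j : ℝ) • dmat j A t := by
  have h := (hA.matSmooth_fundEnd.hasMatDerivAt t).mul (hA.1.hasMatDerivAt_dmat j t)
  simp only [hA.fundEnd_mul_dmat hj] at h
  rw [← h.mderiv_eq]
  cases j with
  | zero =>
    simp only [Nat.cast_zero, zero_smul]
    exact HasMatDerivAt.mderiv_eq fun _ _ => hasDerivAt_const _ _
  | succ j => exact ((hA.1.hasMatDerivAt_dmat j t).const_smul _).mderiv_eq

theorem mderiv_fundEnd_mul_dmat (hA : IsFanning k n A) {j : ℕ} (hj : j + 1 < k) (t : ℝ) :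
    mderiv (fundEnd k n A) t * dmat j A t = -dmat j A t := by
  have h := hA.mderiv_fundEnd_mul_add (Nat.lt_of_succ_lt hj) t
  rw [hA.fundEnd_mul_dmat hj] at h
  rw [eq_sub_of_add_eq h]
  rw [Nat.add_sub_cancel]
  push_cast
  module

theorem mderiv_mderiv_fundEnd_mul_add (hA : IsFanning k n A) {j : ℕ} (hj : j + 1 < k) (t : ℝ) :
    mderiv (mderiv (fundEnd k n A)) t * dmat j A t +
      mderiv (fundEnd k n A) t * dmat (j + 1) A t = -dmat (j + 1) A t := by
  have h := (hA.matSmooth_fundEnd.mderiv.hasMatDerivAt t).mul (hA.1.hasMatDerivAt_dmat j t)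
  simp only [hA.mderiv_fundEnd_mul_dmat hj] at h
  rw [← h.mderiv_eq]
  exact HasMatDerivAt.mderiv_eq fun a b => (hA.1.hasMatDerivAt_dmat j t a b).neg

theorem mderiv_mderiv_fundEnd_mul_dmat (hA : IsFanning k n A) {j : ℕ} (hj : j + 2 < k) (t : ℝ) :
    mderiv (mderiv (fundEnd k n A)) t * dmat j A t = 0 := by
  have h := hA.mderiv_mderiv_fundEnd_mul_add (Nat.lt_of_succ_lt hj) t
  rwa [hA.mderiv_fundEnd_mul_dmat hj, add_eq_right] at h

end

variable {m n : ℕ} {A : ℝ → Matrix (Fin ((m + 2) * n)) (Fin n) ℝ}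
  {P : ℕ → ℝ → Matrix (Fin n) (Fin n) ℝ}

theorem dmat_eq_neg_sum (hP : IsCoeffs (m + 2) n A P) (t : ℝ) :
    dmat (m + 2) A t = -∑ i ∈ Finset.Icc 1 (m + 2),
      ((m + 2).choose i : ℝ) • (dmat (m + 2 - i) A t * P i t) :=
  eq_neg_of_add_eq_zero_left (hP.2 t)

theorem fundEnd_mul_dmat_top (hA : IsFanning (m + 2) n A) (hP : IsCoeffs (m + 2) n A P) (t : ℝ) :
    fundEnd (m + 2) n A t * dmat (m + 2) A t =
      -((m + 2 : ℕ) : ℝ) • (horDer (m + 2) n A P t - dmat (m + 1) A t) := by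
  rw [dmat_eq_neg_sum hP, horDer, Matrix.mul_neg, neg_smul, Matrix.mul_sum,
    Finset.sum_Icc_succ_top (by omega)]
  simp only [Nat.add_one_sub_one, add_sub_cancel_left, Nat.sub_self,
    Matrix.mul_smul, ← Matrix.mul_assoc]
  rw [hA.fundEnd_mul_dmat (by omega : 0 < m + 2), Finset.smul_sum]
  simp only [Nat.cast_zero, zero_smul, Matrix.zero_mul, smul_zero, add_zero, neg_inj]
  refine Finset.sum_congr rfl fun i hi => ?_
  rw [Finset.mem_Icc] at hi
  rw [hA.fundEnd_mul_dmat (by omega), Matrix.smul_mul, smul_smul, smul_smul]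
  have h := Nat.choose_mul_succ_eq (m + 1) i
  congr 1
  · rw [mul_comm ((m + 2 : ℕ) : ℝ)]
    exact_mod_cast h.symm
  · congr 2
    omega

theorem mderiv_fundEnd_mul_sum (hA : IsFanning (m + 2) n A) (c : ℕ → ℝ)
    (Q : ℕ → Matrix (Fin n) (Fin n) ℝ) (t : ℝ) :
    mderiv (fundEnd (m + 2) n A) t *
        ∑ j ∈ Finset.Icc 1 (m + 1), c j • (dmat (m + 1 - j) A t * Q j) =
      -∑ j ∈ Finset.Icc 1 (m + 1), c j • (dmat (m + 1 - j) A t * Q j) := by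
  rw [Matrix.mul_sum, ← Finset.sum_neg_distrib]
  refine Finset.sum_congr rfl fun j hj => ?_
  rw [Finset.mem_Icc] at hj
  rw [Matrix.mul_smul, ← Matrix.mul_assoc, hA.mderiv_fundEnd_mul_dmat (by omega),
    Matrix.neg_mul, smul_neg]

theorem mderiv_fundEnd_mul_dmat_last (hA : IsFanning (m + 2) n A) (hP : IsCoeffs (m + 2) n A P)
    (t : ℝ) :
    mderiv (fundEnd (m + 2) n A) t * dmat (m + 1) A t =
      ((m + 2 : ℕ) : ℝ) • horDer (m + 2) n A P t - dmat (m + 1) A t := by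
  have h := hA.mderiv_fundEnd_mul_add (Nat.lt_succ_self (m + 1)) t
  rw [hA.fundEnd_mul_dmat_top hP] at h
  rw [eq_sub_of_add_eq h]
  push_cast
  module

theorem mderiv_fundEnd_mul_horDer (hA : IsFanning (m + 2) n A) (hP : IsCoeffs (m + 2) n A P)
    (t : ℝ) :
    mderiv (fundEnd (m + 2) n A) t * horDer (m + 2) n A P t =
      ((m + 1 : ℕ) : ℝ) • horDer (m + 2) n A P t := by
  have h := hA.mderiv_fundEnd_mul_sum (fun i => ((m + 1).choose i : ℝ)) (fun i => P i t) t
  conv_lhs => rw [horDer]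
  simp only [Nat.add_one_sub_one, Matrix.mul_add]
  rw [h, hA.mderiv_fundEnd_mul_dmat_last hP]
  simp only [horDer, Nat.add_one_sub_one]
  push_cast
  module

theorem mderiv_mderiv_fundEnd_mul_dmat_penult (hA : IsFanning (m + 2) n A)
    (hP : IsCoeffs (m + 2) n A P) (t : ℝ) :
    mderiv (mderiv (fundEnd (m + 2) n A)) t * dmat m A t =
      -((m + 2 : ℕ) : ℝ) • horDer (m + 2) n A P t := by
  have h := hA.mderiv_mderiv_fundEnd_mul_add (Nat.lt_succ_self (m + 1)) t
  rw [hA.mderiv_fundEnd_mul_dmat_last hP] at h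
  rw [eq_sub_of_add_eq h]
  module

theorem hasMatDerivAt_horDer (hA : IsFanning (m + 2) n A) (hP : IsCoeffs (m + 2) n A P)
    (hP1 : ∀ t, P 1 t = 0) (t : ℝ) :
    HasMatDerivAt (horDer (m + 2) n A P)
      (-∑ j ∈ Finset.Icc 1 (m + 1), ((m + 1).choose j : ℝ) •
        (dmat (m + 1 - j) A t * (P (j + 1) t - mderiv (P j) t))) t := by
  have h : HasMatDerivAt (horDer (m + 2) n A P)
      (dmat (m + 2) A t + ∑ i ∈ Finset.Icc 1 (m + 1), ((m + 1).choose i : ℝ) •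
        (dmat (m + 1 - i + 1) A t * P i t + dmat (m + 1 - i) A t * mderiv (P i) t)) t :=
    (hA.1.hasMatDerivAt_dmat (m + 1) t).add <| HasMatDerivAt.sum fun i hi =>
      ((hA.1.hasMatDerivAt_dmat _ t).mul ((hP.1 i (by
        rw [Finset.mem_Icc] at hi ⊢; omega)).hasMatDerivAt t)).const_smul _
  convert h using 1
  rw [dmat_eq_neg_sum hP, sum_choose_succ_smul (m + 1) fun i => dmat (m + 2 - i) A t * P i t, hP1,
    Matrix.mul_zero, zero_add, neg_add_eq_sub, ← Finset.sum_sub_distrib, ← Finset.sum_neg_distrib]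
  refine Finset.sum_congr rfl fun i hi => ?_
  rw [Finset.mem_Icc] at hi
  rw [show m + 1 - i + 1 = m + 2 - i by omega, show m + 2 - (i + 1) = m + 1 - i by omega,
    Matrix.mul_sub]
  module

theorem mderiv_mderiv_fundEnd_mul_horDer (hA : IsFanning (m + 2) n A)
    (hP : IsCoeffs (m + 2) n A P) (hP1 : ∀ t, P 1 t = 0) (t : ℝ) :
    mderiv (mderiv (fundEnd (m + 2) n A)) t * horDer (m + 2) n A P t =
      -((m + 2 : ℕ) : ℝ) • ∑ j ∈ Finset.Icc 1 (m + 1), ((m + 1).choose j : ℝ) •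
        (dmat (m + 1 - j) A t * (P (j + 1) t - mderiv (P j) t)) := by
  have hH := hA.hasMatDerivAt_horDer hP hP1 t
  have h := (hA.matSmooth_fundEnd.mderiv.hasMatDerivAt t).mul hH
  simp only [hA.mderiv_fundEnd_mul_horDer hP] at h
  have h2 := h.mderiv_eq
  rw [(hH.const_smul _).mderiv_eq, Matrix.mul_neg, hA.mderiv_fundEnd_mul_sum] at h2
  rw [eq_sub_of_add_eq h2.symm]
  push_cast
  module

theorem mderiv_mderiv_fundEnd_mul_tail (hA : IsFanning (m + 2) n A)
    (hP : IsCoeffs (m + 2) n A P) (hP1 : ∀ t, P 1 t = 0) (t : ℝ) :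
    mderiv (mderiv (fundEnd (m + 2) n A)) t * ∑ j ∈ Finset.Icc 1 (m + 1),
        ((m + 1).choose j : ℝ) • (dmat (m + 1 - j) A t * (P (j + 1) t - mderiv (P j) t)) =
      (-((m + 2 : ℕ) : ℝ) * ((m + 1 : ℕ) : ℝ)) • (horDer (m + 2) n A P t * P 2 t) := by
  have hd : mderiv (P 1) t = 0 := by
    rw [funext hP1]
    exact HasMatDerivAt.mderiv_eq fun _ _ => hasDerivAt_const _ _
  rw [Matrix.mul_sum, Finset.sum_eq_single 1]
  · rw [Matrix.mul_smul, ← Matrix.mul_assoc, Nat.add_sub_cancel,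
      hA.mderiv_mderiv_fundEnd_mul_dmat_penult hP, hd, sub_zero, Nat.choose_one_right,
      Matrix.smul_mul, smul_smul,
      mul_comm ((m + 1 : ℕ) : ℝ)]
  · intro j hj hj1
    rw [Finset.mem_Icc] at hj
    rw [Matrix.mul_smul, ← Matrix.mul_assoc, hA.mderiv_mderiv_fundEnd_mul_dmat (by omega),
      Matrix.zero_mul, smul_zero]
  · simp

end IsFanning

/-- The matrix of the Jacobi endomorphism of a normal frame in the
basis `(A | A' | … | A^{(k-2)} | H)`: `K` kills `A, …, A^{(k-3)}`,
`K A^{(k-2)} = ∑_{j=1}^{k-1} C(k-1,j) A^{(k-1-j)} (P_{j+1} - P_j')`, and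
`K H = (k-1) H P₂`. -/
theorem stmt_11 (k n : ℕ) (hk : 2 ≤ k) (hn : 1 ≤ n)
    (A : ℝ → Matrix (Fin (k * n)) (Fin n) ℝ) (hA : IsFanning k n A)
    (P : ℕ → ℝ → Matrix (Fin n) (Fin n) ℝ) (hP : IsCoeffs k n A P)
    (hP1 : ∀ t, P 1 t = 0) (t : ℝ) :
    (∀ i : ℕ, i + 3 ≤ k → jacobiEnd k n A t * dmat i A t = 0) ∧
    jacobiEnd k n A t * dmat (k - 2) A t =
      ∑ j ∈ Finset.Icc 1 (k - 1), ((k - 1).choose j : ℝ) •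
        (dmat (k - 1 - j) A t * (P (j + 1) t - mderiv (P j) t)) ∧
    jacobiEnd k n A t * horDer k n A P t = ((k : ℝ) - 1) • (horDer k n A P t * P 2 t) := by
  obtain ⟨m, rfl⟩ : ∃ m, k = m + 2 := ⟨k - 2, by omega⟩
  have hK : ∀ X : Matrix (Fin ((m + 2) * n)) (Fin n) ℝ,
      jacobiEnd (m + 2) n A t * X = (((m + 2 : ℕ) : ℝ) ^ 2)⁻¹ •
      (mderiv (mderiv (fundEnd (m + 2) n A)) t *
        (mderiv (mderiv (fundEnd (m + 2) n A)) t * X)) := fun X => by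
    rw [jacobiEnd, Matrix.smul_mul, Matrix.mul_assoc]
  have hk0 : ((m + 2 : ℕ) : ℝ) ≠ 0 := by positivity
  refine ⟨fun i hi => ?_, ?_, ?_⟩
  · rw [hK, hA.mderiv_mderiv_fundEnd_mul_dmat (by omega), Matrix.mul_zero, smul_zero]
  · change jacobiEnd (m + 2) n A t * dmat m A t = _
    rw [hK, hA.mderiv_mderiv_fundEnd_mul_dmat_penult hP, Matrix.mul_smul,
      hA.mderiv_mderiv_fundEnd_mul_horDer hP hP1, smul_smul, smul_smul]
    refine Eq.trans ?_ (one_smul ℝ _)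
    congr 1
    field_simp
  · rw [hK, hA.mderiv_mderiv_fundEnd_mul_horDer hP hP1, Matrix.mul_smul,
      hA.mderiv_mderiv_fundEnd_mul_tail hP hP1, smul_smul, smul_smul]
    congr 1
    push_cast at hk0 ⊢
    field_simp
    ring
end

section
/- For every (k+1)-tuple (A_0,…,A_k) of (kn)×n real matrices with (A_0|…|A_{k−1}) invertible, there exist an invertible (kn)×(kn) real matrix T and n×n real matrices X_0,…,X_k with X_0 invertible such that Σ_{i=0}^{r} C(r,i)·T·A_{r−i}·X_i = E_r for all 0 ≤ r ≤ k−1 and Σ_{i=0}^{k} C(k,i)·T·A_{k−i}·X_i = 0. (Hence GL(kn) acts transitively on the space of k-jets of fanning curves in Gr(n, ℝ^{kn}).) -/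
open Matrix

/-- `E_i`: the `(kn) × n` matrix whose `i`-th `n × n` block is the identity and whose
other blocks vanish. -/
noncomputable def stdE (k n : ℕ) (i : Fin k) : Matrix (Fin (k * n)) (Fin n) ℝ :=
  Matrix.of fun r c => if r = finProdFinEquiv (i, c) then 1 else 0

theorem juxt_mul {k n m : ℕ} (B : Fin k → Matrix (Fin (k * n)) (Fin n) ℝ)
    (P : Matrix (Fin (k * n)) (Fin m) ℝ) :
    juxt k n B * P =
      ∑ j : Fin k, B j * Matrix.of fun (c : Fin n) (d : Fin m) => P (finProdFinEquiv (j, c)) d := by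
  ext r d
  simp only [Matrix.mul_apply, Matrix.sum_apply, juxt, Matrix.of_apply]
  rw [← finProdFinEquiv.sum_comp, Fintype.sum_prod_type]
  simp

theorem mul_juxt {k n : ℕ} (J : Matrix (Fin (k * n)) (Fin (k * n)) ℝ)
    (M : Fin k → Matrix (Fin (k * n)) (Fin n) ℝ) :
    J * juxt k n M = juxt k n fun i => J * M i := by
  ext r c
  simp [juxt, Matrix.mul_apply]

theorem juxt_mul_stdE {k n : ℕ} (B : Fin k → Matrix (Fin (k * n)) (Fin n) ℝ) (i : Fin k) :
    juxt k n B * stdE k n i = B i := by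
  ext r c
  simp [juxt, stdE, Matrix.mul_apply, -finProdFinEquiv_symm_apply]

/-- The Leibniz action of a jet with `X₀ = 1` preserves fanning tuples. -/
theorem isUnit_juxt_leibniz {k n : ℕ} (A : ℕ → Matrix (Fin (k * n)) (Fin n) ℝ)
    (hA : IsUnit (juxt k n fun i : Fin k => A i)) (X : ℕ → Matrix (Fin n) (Fin n) ℝ)
    (hX : X 0 = 1) :
    IsUnit (juxt k n fun r : Fin k =>
      ∑ i ∈ Finset.range ((r : ℕ) + 1), ((r : ℕ).choose i : ℝ) • (A ((r : ℕ) - i) * X i)) := by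
  set B : Fin k → Matrix (Fin (k * n)) (Fin n) ℝ := fun r =>
    ∑ i ∈ Finset.range ((r : ℕ) + 1), ((r : ℕ).choose i : ℝ) • (A ((r : ℕ) - i) * X i) with hB
  have key : ∀ r, r < k → ∃ M : Matrix (Fin (k * n)) (Fin n) ℝ, A r = juxt k n B * M := by
    intro r
    induction r using Nat.strong_induction_on with
    | _ r ih =>
      intro hr
      have h : ∀ j, ∃ M : Matrix (Fin (k * n)) (Fin n) ℝ, j < r → A j = juxt k n B * M := by
        intro j
        by_cases hj : j < r
        · obtain ⟨M, hM⟩ := ih j hj (hj.trans hr)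
          exact ⟨M, fun _ => hM⟩
        · exact ⟨0, fun h => absurd h hj⟩
      choose M hM using h
      have hBr : B ⟨r, hr⟩ =
          (∑ i ∈ Finset.range r, (r.choose (i + 1) : ℝ) • (A (r - (i + 1)) * X (i + 1))) + A r := by
        simp only [hB]
        rw [Finset.sum_range_succ']
        simp [hX]
      refine ⟨stdE k n ⟨r, hr⟩ -
        ∑ i ∈ Finset.range r, (r.choose (i + 1) : ℝ) • (M (r - (i + 1)) * X (i + 1)), ?_⟩
      rw [Matrix.mul_sub, juxt_mul_stdE, hBr, Matrix.mul_sum, eq_sub_iff_add_eq, add_comm]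
      congr 1
      refine Finset.sum_congr rfl fun i hi => ?_
      have hi' := Finset.mem_range.1 hi
      rw [hM (r - (i + 1)) (by omega), Matrix.mul_smul, Matrix.mul_assoc]
  choose M hM using fun r : Fin k => key r r.2
  have hJ : juxt k n (fun i : Fin k => A i) = juxt k n B * juxt k n M := by
    rw [mul_juxt]
    exact congrArg _ (funext hM)
  rw [hJ, Matrix.isUnit_iff_isUnit_det, Matrix.det_mul] at hA
  exact (Matrix.isUnit_iff_isUnit_det _).2 (isUnit_of_mul_isUnit_left hA)

/-- For a fanning tuple, a jet with `X₀ = 1` can be chosen to kill the top derivative. -/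
theorem exists_jet_leibniz_eq_zero {k n : ℕ} (A : ℕ → Matrix (Fin (k * n)) (Fin n) ℝ)
    (hA : IsUnit (juxt k n fun i : Fin k => A i)) :
    ∃ X : ℕ → Matrix (Fin n) (Fin n) ℝ, X 0 = 1 ∧
      ∑ i ∈ Finset.range (k + 1), (k.choose i : ℝ) • (A (k - i) * X i) = 0 := by
  set P := (juxt k n fun i : Fin k => A i)⁻¹ * A k
  let Q : ℕ → Matrix (Fin n) (Fin n) ℝ := fun j =>
    if h : j < k then Matrix.of fun c d => P (finProdFinEquiv (⟨j, h⟩, c)) d else 0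
  have hAk : A k = ∑ j ∈ Finset.range k, A j * Q j := by
    have h : juxt k n (fun i : Fin k => A i) * P = A k :=
      Matrix.mul_nonsing_inv_cancel_left _ _ ((Matrix.isUnit_iff_isUnit_det _).1 hA)
    rw [← h, juxt_mul, Finset.sum_range]
    simp [Q]
  refine ⟨fun i => if i = 0 then 1 else -((k.choose i : ℝ)⁻¹ • Q (k - i)), by simp, ?_⟩
  rw [Finset.sum_range_succ']
  have h : ∀ i ∈ Finset.range k, (k.choose (i + 1) : ℝ) • (A (k - (i + 1)) *
      (if i + 1 = 0 then 1 else -((k.choose (i + 1) : ℝ)⁻¹ • Q (k - (i + 1))))) =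
      -(A (k - 1 - i) * Q (k - 1 - i)) := by
    intro i hi
    have hi' := Finset.mem_range.1 hi
    have hc : (k.choose (i + 1) : ℝ) ≠ 0 := by
      exact_mod_cast (Nat.choose_pos (by omega)).ne'
    rw [if_neg (Nat.succ_ne_zero i), Nat.sub_sub, Nat.add_comm 1 i, Matrix.mul_neg,
      Matrix.mul_smul, smul_neg, smul_smul, mul_inv_cancel₀ hc, one_smul]
  rw [Finset.sum_congr rfl h, Finset.sum_neg_distrib,
    Finset.sum_range_reflect (fun j => A j * Q j) k, ← hAk]
  simp

/-- `GL(kn)` acts transitively on `k`-jets of fanning curves in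
`Gr(n, ℝ^{kn})`: acting on the left by a suitable `T ∈ GL(kn)` and on the right by a
suitable `k`-jet `(X₀, …, X_k)` with `X₀` invertible brings any fanning `(k+1)`-tuple to
`(E₀, …, E_{k-1}, 0)`. -/
theorem stmt_15 (k n : ℕ) (hk : 2 ≤ k) (hn : 1 ≤ n)
    (A : ℕ → Matrix (Fin (k * n)) (Fin n) ℝ)
    (hA : IsUnit (juxt k n fun i : Fin k => A i)) :
    ∃ (T : Matrix (Fin (k * n)) (Fin (k * n)) ℝ) (X : ℕ → Matrix (Fin n) (Fin n) ℝ),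
      IsUnit T ∧ IsUnit (X 0) ∧
      (∀ r : Fin k, ∑ i ∈ Finset.range ((r : ℕ) + 1),
          ((r : ℕ).choose i : ℝ) • (T * A ((r : ℕ) - i) * X i) = stdE k n r) ∧
      ∑ i ∈ Finset.range (k + 1), (k.choose i : ℝ) • (T * A (k - i) * X i) = 0 := by
  obtain ⟨X, hX, hXk⟩ := exists_jet_leibniz_eq_zero A hA
  have hJ := isUnit_juxt_leibniz A hA X hX
  have hd := (Matrix.isUnit_iff_isUnit_det _).1 hJ
  have hmul : ∀ (T : Matrix (Fin (k * n)) (Fin (k * n)) ℝ) (r : ℕ),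
      ∑ i ∈ Finset.range (r + 1), (r.choose i : ℝ) • (T * A (r - i) * X i) =
        T * ∑ i ∈ Finset.range (r + 1), (r.choose i : ℝ) • (A (r - i) * X i) := by
    intro T r
    simp only [Matrix.mul_sum, Matrix.mul_smul, Matrix.mul_assoc]
  refine ⟨_, X, (Matrix.isUnit_nonsing_inv_iff).2 hJ, by simp [hX], fun r => ?_, ?_⟩
  · rw [hmul]
    have h := juxt_mul_stdE (fun r : Fin k => ∑ i ∈ Finset.range ((r : ℕ) + 1),
      ((r : ℕ).choose i : ℝ) • (A ((r : ℕ) - i) * X i)) r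
    beta_reduce at h
    conv_lhs => rw [← h]
    exact Matrix.nonsing_inv_mul_cancel_left _ _ hd
  · rw [hmul, hXk, Matrix.mul_zero]
end
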